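/- Let R be a commutative ring, v a pre-valuation on R with associated filtration (a_n), and d ∈ ℕ. Then the function v^♯ on the polynomial ring R[x] defined by v^♯(Σ_i c_i x^i) = min_i ( v(c_i) + i·d ) is a pre-valuation on R[x], and its associated filtration is given for each n by a^♯_n = Σ_{(i,j) : i + d·j ≥ n} a_i · (x^j), the ideal of R[x] generated by all elements c·x^j with c ∈ a_i and i + d·j ≥ n. -/

import Mathlib

/-- A pre-valuation on a commutative ring `R`. -/
structure PreVal (R : Type*) [CommRing R] where
  v : R → ℕ∞
  map_zero : v 0 = ⊤
  mul_le : ∀ x y : R, v x + v y ≤ v (x * y)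
  min_le_add : ∀ x y : R, min (v x) (v y) ≤ v (x + y)
  add_eq : ∀ x y : R, v x ≠ v y → v (x + y) = min (v x) (v y)

/-- The ideal `a_{v,n} = {x | v x ≥ n}` associated to a pre-valuation. -/
def PreVal.ideal {R : Type*} [CommRing R] (v : PreVal R) (n : ℕ) : Ideal R where
  carrier := {x : R | (n : ℕ∞) ≤ v.v x}
  zero_mem' := by simp [Set.mem_setOf_eq, v.map_zero]
  add_mem' := by
    intro x y hx hy
    exact le_trans (le_min hx hy) (v.min_le_add x y)
  smul_mem' := by
    intro c x hx
    simp only [smul_eq_mul, Set.mem_setOf_eq]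
    calc (n : ℕ∞) ≤ v.v x := hx
      _ ≤ v.v c + v.v x := le_add_self
      _ ≤ v.v (c * x) := v.mul_le c x

/-- The pre-valuation `v^♯` on `R[x]`: `v^♯(Σ c_i x^i) = min_i (v(c_i) + i·d)`. -/
noncomputable def vsharp {R : Type*} [CommRing R] (v : PreVal R) (d : ℕ)
    (p : Polynomial R) : ℕ∞ :=
  ⨅ i : ℕ, v.v (p.coeff i) + ((i * d : ℕ) : ℕ∞)

theorem PreVal.le_sum {R ι : Type*} [CommRing R] (v : PreVal R) (M c : ℕ∞) (s : Finset ι)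
    (f : ι → R) (h : ∀ i ∈ s, M ≤ v.v (f i) + c) : M ≤ v.v (∑ i ∈ s, f i) + c := by
  classical
  induction s using Finset.induction_on with
  | empty => simp [v.map_zero]
  | insert a s ha ih =>
    rw [Finset.sum_insert ha]
    have h1 := h a (Finset.mem_insert_self a s)
    have h2 := ih (fun i hi => h i (Finset.mem_insert_of_mem hi))
    refine le_trans ?_ (add_le_add_left (v.min_le_add _ _) c)
    rcases min_choice (v.v (f a)) (v.v (∑ i ∈ s, f i)) with h | h <;> rw [h] <;> assumption

theorem vsharp_le {R : Type*} [CommRing R] (v : PreVal R) (d : ℕ) (p : Polynomial R) (i : ℕ) :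
    vsharp v d p ≤ v.v (p.coeff i) + ((i * d : ℕ) : ℕ∞) := iInf_le _ i

theorem vsharp_zero {R : Type*} [CommRing R] (v : PreVal R) (d : ℕ) :
    vsharp v d (0 : Polynomial R) = ⊤ := by
  simp [vsharp, v.map_zero]

theorem vsharp_mul {R : Type*} [CommRing R] (v : PreVal R) (d : ℕ) (p q : Polynomial R) :
    vsharp v d p + vsharp v d q ≤ vsharp v d (p * q) := by
  refine le_iInf fun n => ?_
  rw [Polynomial.coeff_mul]
  refine v.le_sum _ _ _ _ fun x hx => ?_
  rw [Finset.HasAntidiagonal.mem_antidiagonal] at hx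
  calc _ ≤ _ := add_le_add (vsharp_le v d p x.1) (vsharp_le v d q x.2)
    _ = (v.v (p.coeff x.1) + v.v (q.coeff x.2)) + ((n * d : ℕ) : ℕ∞) := by
      rw [← hx]; push_cast; ring
    _ ≤ _ := add_le_add_left (v.mul_le _ _) _

theorem vsharp_add {R : Type*} [CommRing R] (v : PreVal R) (d : ℕ) (p q : Polynomial R) :
    min (vsharp v d p) (vsharp v d q) ≤ vsharp v d (p + q) := by
  refine le_iInf fun n => ?_
  rw [Polynomial.coeff_add]
  refine le_trans ?_ (add_le_add_left (v.min_le_add _ _) _)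
  rcases min_choice (v.v (p.coeff n)) (v.v (q.coeff n)) with h | h <;> rw [h]
  · exact (min_le_left _ _).trans (vsharp_le v d p n)
  · exact (min_le_right _ _).trans (vsharp_le v d q n)

theorem vsharp_add_lt {R : Type*} [CommRing R] (v : PreVal R) (d : ℕ) (p q : Polynomial R)
    (h : vsharp v d p < vsharp v d q) : vsharp v d (p + q) = vsharp v d p := by
  apply le_antisymm
  · obtain ⟨i, hi⟩ := ENat.exists_eq_iInf
      (fun i : ℕ => v.v (p.coeff i) + ((i * d : ℕ) : ℕ∞))
    change _ = vsharp v d p at hi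
    have h1 : v.v (p.coeff i) < v.v (q.coeff i) := by
      have := h.trans_le (vsharp_le v d q i)
      rw [← hi] at this
      exact lt_of_add_lt_add_right this
    have h2 := vsharp_le v d (p + q) i
    rwa [Polynomial.coeff_add, v.add_eq _ _ h1.ne, min_eq_left h1.le, hi] at h2
  · have := vsharp_add v d p q
    rwa [min_eq_left h.le] at this

/-- The pre-valuation on the polynomial ring. -/
noncomputable def sharpPreVal {R : Type*} [CommRing R] (v : PreVal R) (d : ℕ) :
    PreVal (Polynomial R) where
  v := vsharp v d
  map_zero := vsharp_zero v d
  mul_le := vsharp_mul v d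
  min_le_add := vsharp_add v d
  add_eq := by
    intro p q h
    rcases lt_or_gt_of_ne h with h | h
    · rw [vsharp_add_lt v d p q h, min_eq_left h.le]
    · rw [add_comm, vsharp_add_lt v d q p h, min_eq_right h.le]

theorem le_vsharp_monomial {R : Type*} [CommRing R] (v : PreVal R) (d j : ℕ) (c : R) :
    v.v c + ((j * d : ℕ) : ℕ∞) ≤ vsharp v d (Polynomial.C c * Polynomial.X ^ j) := by
  refine le_iInf fun i => ?_
  rw [Polynomial.coeff_C_mul_X_pow]
  split_ifs with h
  · rw [h]
  · simp [v.map_zero]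

/-- `v^♯` is a pre-valuation on `R[x]` and its associated filtration is
`a^♯_n = Σ_{i + d·j ≥ n} a_i · (x^j)`, the ideal of `R[x]` generated by all `c·x^j`
with `c ∈ a_i` and `i + d·j ≥ n`. -/
theorem stmt9 {R : Type*} [CommRing R] (v : PreVal R) (d : ℕ) :
    ∃ w : PreVal (Polynomial R),
      (∀ p : Polynomial R, w.v p = vsharp v d p) ∧
      ∀ n : ℕ,
        ({p : Polynomial R | (n : ℕ∞) ≤ vsharp v d p} : Set (Polynomial R)) =
          ((⨆ (i : ℕ) (j : ℕ) (_ : n ≤ i + d * j),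
              (v.ideal i).map (Polynomial.C : R →+* Polynomial R) *
                Ideal.span {Polynomial.X ^ j} : Ideal (Polynomial R)) : Set (Polynomial R)) := by
  refine ⟨sharpPreVal v d, fun _ => rfl, fun n => ?_⟩
  change (((sharpPreVal v d).ideal n : Ideal (Polynomial R)) : Set (Polynomial R)) = _
  congr 1
  apply le_antisymm
  · intro p hp
    change (n : ℕ∞) ≤ vsharp v d p at hp
    rw [p.as_sum_support_C_mul_X_pow]
    refine Ideal.sum_mem _ fun j _ => ?_
    have h1 := hp.trans (vsharp_le v d p j)
    have hn : n ≤ n - d * j + d * j := by omega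
    refine Submodule.mem_iSup_of_mem (n - d * j) (Submodule.mem_iSup_of_mem j ?_)
    rw [iSup_pos hn]
    refine Ideal.mul_mem_mul (Ideal.mem_map_of_mem _ ?_) (Ideal.mem_span_singleton_self _)
    change ((n - d * j : ℕ) : ℕ∞) ≤ v.v (p.coeff j)
    generalize v.v (p.coeff j) = a at h1
    induction a using ENat.recTopCoe with
    | top => exact le_top
    | coe a =>
      norm_cast at h1 ⊢
      rw [mul_comm d j]
      omega
  · refine iSup_le fun i => iSup_le fun j => iSup_le fun hij => ?_
    rw [Ideal.map, Ideal.span_mul_span', Ideal.span_le]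
    rintro _ ⟨_, ⟨c, hc, rfl⟩, _, rfl, rfl⟩
    change (n : ℕ∞) ≤ vsharp v d (Polynomial.C c * Polynomial.X ^ j)
    refine le_trans ?_ (le_vsharp_monomial v d j c)
    have hc' : (i : ℕ∞) ≤ v.v c := hc
    refine le_trans ?_ (add_le_add_left hc' _)
    rw [mul_comm j d]
    exact_mod_cast hij
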